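/- Let X be a finite-dimensional real normed vector space and let A > 1. There exists a constant C > 0, depending only on A and X, with the following property. Let Γ ⊆ X be a rectifiable curve, let E ⊆ Γ be nonempty, and let G be a partial multiresolution family for E with inflation factor A. Then S_{E,2}(G) := diam E + Σ_{Q ∈ G} β_E(Q)²·diam Q ≤ C·H^1(Γ). -/

import Mathlib

open Metric MeasureTheory Set Bornology
open scoped ENNReal NNReal Classical

universe u

noncomputable section

/-- The affine line through `a` with direction `v`. -/
def lineThrough {X : Type u} [AddCommGroup X] [Module ℝ X] (a v : X) : Set X :=
  {y | ∃ t : ℝ, y = a + t • v}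

/-- The Jones beta number of `E` in the window `Q`:
`β_E(Q) = inf_L sup_{x ∈ E ∩ Q} dist(x,L)/diam Q`, with value `0` if `E ∩ Q = ∅`. -/
def jonesBeta {X : Type u} [NormedAddCommGroup X] [NormedSpace ℝ X] (E Q : Set X) : ℝ :=
  if E ∩ Q = ∅ then 0
  else sInf {r : ℝ | ∃ a v : X, v ≠ 0 ∧
    r = sSup ((fun x => infDist x (lineThrough a v) / Metric.diam Q) '' (E ∩ Q))}

/-- `net` encodes a partial multiresolution family for `E`: a nested family of
`2^{-k}`-separated subsets of `E`. -/
def IsPartialMultiresolution {X : Type u} [NormedAddCommGroup X]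
    (E : Set X) (net : ℤ → Set X) : Prop :=
  (∀ k, net k ⊆ E) ∧ (∀ k, net k ⊆ net (k + 1)) ∧
    (∀ k : ℤ, ∀ x ∈ net k, ∀ y ∈ net k, x ≠ y → (2 : ℝ) ^ (-k) ≤ dist x y)

/-- `net` encodes a multiresolution family for `E`: a nested family of `2^{-k}`-nets for `E`. -/
def IsMultiresolution {X : Type u} [NormedAddCommGroup X]
    (E : Set X) (net : ℤ → Set X) : Prop :=
  IsPartialMultiresolution E net ∧ ∀ k : ℤ, ∀ e ∈ E, ∃ x ∈ net k, dist e x ≤ (2 : ℝ) ^ (-k)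

/-- The sum `Σ_{Q ∈ G} β_E(Q)^p · diam Q` over the (partial) multiresolution family
`G = {B(x, A·2^{-k}) : x ∈ net k, k ∈ ℤ}` with inflation factor `A`. -/
def betaSum {X : Type u} [NormedAddCommGroup X] [NormedSpace ℝ X]
    (E : Set X) (net : ℤ → Set X) (A p : ℝ) : ℝ≥0∞ :=
  ∑' (k : ℤ), ∑' (x : net k),
    ENNReal.ofReal (jonesBeta E (closedBall (x : X) (A * (2 : ℝ) ^ (-k))) ^ p *
      Metric.diam (closedBall (x : X) (A * (2 : ℝ) ^ (-k))))

/-- `S_{E,p}(G) = diam E + Σ_{Q ∈ G} β_E(Q)^p · diam Q`. -/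
def SEp {X : Type u} [NormedAddCommGroup X] [NormedSpace ℝ X]
    (E : Set X) (net : ℤ → Set X) (A p : ℝ) : ℝ≥0∞ :=
  ENNReal.ofReal (Metric.diam E) + betaSum E net A p

/-- `Γ` is a rectifiable curve: the image of a continuous map `[0,1] → X` with
finite one-dimensional Hausdorff measure. -/
def IsRectifiableCurve {X : Type u} [NormedAddCommGroup X]
    [MeasurableSpace X] [BorelSpace X] (Γ : Set X) : Prop :=
  (∃ f : ℝ → X, ContinuousOn f (Set.Icc (0 : ℝ) 1) ∧ Γ = f '' Set.Icc (0 : ℝ) 1) ∧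
    μH[1] Γ < ⊤

/-- A path-connected set contains a connected piece crossing a given annulus. -/
lemma exists_arc_across_annulus {X : Type*} [PseudoMetricSpace X] {Γ : Set X}
    (hΓ : IsPathConnected Γ) {c q : X} (hc : c ∈ Γ) (hq : q ∈ Γ) {c₁ c₂ : ℝ} (h₀ : 0 ≤ c₁)
    (h₁₂ : c₁ ≤ c₂) (h₂ : c₂ ≤ dist q c) :
    ∃ α ⊆ Γ, IsPreconnected α ∧ (∃ u ∈ α, dist u c = c₁) ∧ (∃ v ∈ α, dist v c = c₂) ∧
      ∀ a ∈ α, c₁ ≤ dist a c ∧ dist a c ≤ c₂ := by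
  obtain ⟨γ, hγ⟩ := hΓ.joinedIn c hc q hq
  set g : unitInterval → ℝ := fun t => dist (γ t) c with hg
  have hgc : Continuous g := by fun_prop
  have hg0 : g 0 = 0 := by simp [hg]
  have hg1 : g 1 = dist q c := by simp [hg]
  obtain ⟨t₂, ht₂, hmin⟩ := (isClosed_le continuous_const hgc : IsClosed {t | c₂ ≤ g t}).isCompact.exists_isLeast
    ⟨1, by simpa [hg1] using h₂⟩
  have e₂ : g t₂ = c₂ := by
    obtain ⟨t, ht, hte⟩ := intermediate_value_Icc (f := g) (show (0 : unitInterval) ≤ t₂ from t₂.2.1)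
      hgc.continuousOn ⟨by rw [hg0]; linarith, ht₂⟩
    have := hmin (show c₂ ≤ g t from hte.ge)
    rwa [le_antisymm ht.2 this] at hte
  obtain ⟨t₁, ht₁, hmax⟩ := ((isClosed_le hgc continuous_const :
      IsClosed {t | g t ≤ c₁}).inter isClosed_Iic).isCompact.exists_isGreatest
    (⟨0, by simpa [hg0] using h₀, t₂.2.1⟩ : ({t | g t ≤ c₁} ∩ Iic t₂).Nonempty)
  have h₁₂' : t₁ ≤ t₂ := ht₁.2
  have e₁ : g t₁ = c₁ := by
    obtain ⟨t, ht, hte⟩ := intermediate_value_Icc (f := g) h₁₂'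
      hgc.continuousOn ⟨ht₁.1, by rw [e₂]; exact h₁₂⟩
    have := hmax ⟨show g t ≤ c₁ from hte.le, ht.2⟩
    rwa [le_antisymm this ht.1] at hte
  refine ⟨γ '' Icc t₁ t₂, ?_, isPreconnected_Icc.image _ γ.continuous.continuousOn,
    ⟨γ t₁, mem_image_of_mem _ ⟨le_rfl, h₁₂'⟩, e₁⟩, ⟨γ t₂, mem_image_of_mem _ ⟨h₁₂', le_rfl⟩, e₂⟩, ?_⟩
  · rintro _ ⟨t, -, rfl⟩
    exact hγ t
  · rintro _ ⟨t, ht, rfl⟩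
    constructor
    · by_contra! h
      have := hmax ⟨show g t ≤ c₁ from h.le, ht.2⟩
      rw [le_antisymm this ht.1] at h
      exact h.ne e₁
    · by_contra! h
      have := hmin (show c₂ ≤ g t from h.le)
      rw [le_antisymm ht.2 this] at h
      exact h.ne' e₂

/-- A packing bound in finite-dimensional normed spaces. -/
lemma exists_card_le_of_separated (X : Type*) [NormedAddCommGroup X] [NormedSpace ℝ X]
    [FiniteDimensional ℝ X] (K : ℝ) :
    ∃ M : ℕ, ∀ (c : X) (r : ℝ) (s : Finset X), 0 < r → (∀ x ∈ s, dist x c ≤ K * r) →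
      (∀ x ∈ s, ∀ y ∈ s, x ≠ y → r ≤ dist x y) → s.card ≤ M := by
  have : ProperSpace X := FiniteDimensional.proper_real X
  obtain ⟨t, -, ht, hcov⟩ := finite_cover_balls_of_compact (isCompact_closedBall (0 : X) K)
    (show (0 : ℝ) < 1 / 2 by norm_num)
  refine ⟨ht.toFinset.card, fun c r s hr hs hsep => ?_⟩
  have key : ∀ x ∈ s, ∃ p ∈ t, dist (r⁻¹ • (x - c)) p < 1 / 2 := by
    intro x hx
    have : r⁻¹ • (x - c) ∈ closedBall (0 : X) K := by
      rw [mem_closedBall_zero_iff, norm_smul, norm_inv, Real.norm_of_nonneg hr.le, ← dist_eq_norm,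
        inv_mul_le_iff₀ hr, mul_comm]
      exact hs x hx
    simpa using hcov this
  choose! φ hφ hφ' using key
  refine Finset.card_le_card_of_injOn φ (fun x hx => by simpa using hφ x hx) fun x hx y hy hxy => ?_
  by_contra hne
  have h1 := hφ' x hx
  have h2 := hφ' y hy
  rw [hxy] at h1
  have h3 : dist (r⁻¹ • (x - c)) (r⁻¹ • (y - c)) < 1 := by
    linarith [dist_triangle_right (r⁻¹ • (x - c)) (r⁻¹ • (y - c)) (φ y)]
  rw [dist_eq_norm, ← smul_sub, sub_sub_sub_cancel_right, norm_smul, norm_inv,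
    Real.norm_of_nonneg hr.le, ← dist_eq_norm, inv_mul_lt_iff₀ hr] at h3
  linarith [hsep x hx y hy hne]

/-- Farthest-point ordering of a finite metric space, recorded by insertion distances `d`. -/
lemma exists_farthest_point_weights {X : Type*} [MetricSpace X] (P : Finset X) (S : ℝ) :
    ∃ d : X → ℝ, (∀ p ∈ P, ∀ q ∈ P, p ≠ q → min (d p) (d q) ≤ dist p q) ∧
      ∀ s, 0 < s → s ≤ S → ∀ p ∈ P, ∃ q ∈ P, s ≤ d q ∧ dist p q < s := by
  rcases P.eq_empty_or_nonempty with rfl | ⟨p₀, hp₀⟩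
  · exact ⟨fun _ => 0, by simp, by simp⟩
  suffices H : ∀ n, n + 1 ≤ P.card → ∃ M ⊆ P, M.card = n + 1 ∧ ∃ d : X → ℝ,
      (∀ p ∈ M, ∀ q ∈ M, p ≠ q → min (d p) (d q) ≤ dist p q) ∧
      ∀ s, 0 < s → s ≤ S → (∀ p ∈ P, ∃ q ∈ M, s ≤ d q ∧ dist p q < s) ∨ ∀ p ∈ M, s ≤ d p by
    have hpos : 0 < P.card := Finset.card_pos.2 ⟨p₀, hp₀⟩
    obtain ⟨M, hMP, hM, d, hd, hd'⟩ := H (P.card - 1) (by omega)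
    obtain rfl : M = P := Finset.eq_of_subset_of_card_le hMP (by omega)
    refine ⟨d, hd, fun s hs hS p hp => ?_⟩
    rcases hd' s hs hS with h | h
    · exact h p hp
    · exact ⟨p, hp, h p hp, by simpa using hs⟩
  intro n
  induction n with
  | zero =>
    intro _
    refine ⟨{p₀}, by simpa using hp₀, by simp, fun _ => S, ?_, fun s _ hS => Or.inr fun _ _ => hS⟩
    intro p hp q hq hpq
    simp only [Finset.mem_singleton] at hp hq
    exact absurd (hp.trans hq.symm) hpq
  | succ n ih =>
    intro hn
    obtain ⟨M, hMP, hM, d, hd, hd'⟩ := ih (by omega)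
    have hne : (P \ M).Nonempty := by
      rw [← Finset.card_pos, Finset.card_sdiff_of_subset hMP]; omega
    have hMne : (M : Set X).Nonempty := by
      rw [Finset.coe_nonempty, ← Finset.card_pos]; omega
    obtain ⟨q, hq, hqmax⟩ := Finset.exists_max_image (P \ M) (fun x => infDist x (M : Set X)) hne
    rw [Finset.mem_sdiff] at hq
    set ρ := infDist q (M : Set X) with hρ
    have hqM : ∀ p ∈ M, ρ ≤ dist q p := fun p hp => infDist_le_dist_of_mem (by simpa using hp)
    have hcov : ∀ s, ρ < s → ∀ p ∈ P, ∃ q ∈ M, dist p q < s := by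
      intro s hs p hp
      by_cases hpM : p ∈ M
      · exact ⟨p, hpM, by rw [dist_self]; exact infDist_nonneg.trans_lt hs⟩
      · have := (hqmax p (Finset.mem_sdiff.2 ⟨hp, hpM⟩)).trans_lt hs
        simpa using (infDist_lt_iff hMne).1 this
    have hdp : ∀ p ∈ M, Function.update d q ρ p = d p := fun p hp =>
      Function.update_of_ne (fun h => hq.2 (by rw [← h]; exact hp)) _ _
    refine ⟨insert q M, ?_, ?_, Function.update d q ρ, ?_, ?_⟩
    · exact Finset.insert_subset hq.1 hMP
    · rw [Finset.card_insert_of_notMem hq.2, hM]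
    · intro a ha b hb hab
      rw [Finset.mem_insert] at ha hb
      rcases ha with rfl | ha <;> rcases hb with rfl | hb
      · exact absurd rfl hab
      · rw [Function.update_self]
        exact (min_le_left _ _).trans (hqM b hb)
      · rw [Function.update_self, dist_comm]
        exact (min_le_right _ _).trans (hqM a ha)
      · rw [hdp a ha, hdp b hb]
        exact hd a ha b hb hab
    · intro s hs hS
      rcases hd' s hs hS with h | h
      · left
        intro p hp
        obtain ⟨x, hx, h1, h2⟩ := h p hp
        exact ⟨x, Finset.mem_insert_of_mem hx, by rwa [hdp x hx], h2⟩
      · by_cases hsρ : s ≤ ρ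
        · right
          intro p hp
          rw [Finset.mem_insert] at hp
          rcases hp with rfl | hp
          · rwa [Function.update_self]
          · rw [hdp p hp]; exact h p hp
        · left
          intro p hp
          obtain ⟨x, hx, h2⟩ := hcov s (not_le.1 hsρ) p hp
          exact ⟨x, Finset.mem_insert_of_mem hx, by rw [hdp x hx]; exact h x hx, h2⟩

/-- The number of dyadic scales in a bounded multiplicative window. -/
lemma exists_card_dyadic_le (T : ℝ) :
    ∃ J : ℕ, ∀ (u : ℝ) (s : Finset ℤ), 0 < u →
      (∀ k ∈ s, u ≤ (2 : ℝ) ^ (-k) ∧ (2 : ℝ) ^ (-k) ≤ T * u) → s.card ≤ J := by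
  refine ⟨⌈T⌉₊ + 1, fun u s hu hs => ?_⟩
  rcases s.eq_empty_or_nonempty with rfl | hne
  · simp
  set m := s.min' hne
  have hm : m ∈ s := s.min'_mem hne
  have hsub : s ⊆ Finset.Icc m (m + ⌈T⌉₊) := by
    intro k hk
    have hmk : m ≤ k := s.min'_le k hk
    rw [Finset.mem_Icc]
    refine ⟨hmk, ?_⟩
    obtain ⟨n, hn⟩ := Int.eq_ofNat_of_zero_le (sub_nonneg.2 hmk)
    have h1 := (hs k hk).1
    have h2 := (hs m hm).2
    have h3 : (2 : ℝ) ^ (-m) = 2 ^ n * 2 ^ (-k) := by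
      rw [← zpow_natCast, ← zpow_add₀ (two_ne_zero)]
      congr 1; omega
    have h4 : (2 : ℝ) ^ n ≤ T := by
      have : (2 : ℝ) ^ n * u ≤ T * u := by
        calc (2 : ℝ) ^ n * u ≤ 2 ^ n * 2 ^ (-k) := by gcongr
          _ ≤ T * u := h3 ▸ h2
      exact le_of_mul_le_mul_right this hu
    have h5 : (n : ℝ) < 2 ^ n := by exact_mod_cast Nat.lt_two_pow_self
    have h6 : n ≤ ⌈T⌉₊ := by
      exact_mod_cast (h5.le.trans h4).trans (Nat.le_ceil T)
    omega
  calc s.card ≤ _ := Finset.card_le_card hsub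
    _ = ⌈T⌉₊ + 1 := by rw [Int.card_Icc]; omega

/-- A finite set of `n` points is spread out, at unit relative scale, in at most `O(n)` of the balls
of a separated dyadic family. -/
lemma exists_card_spread_balls_le (X : Type*) [NormedAddCommGroup X] [NormedSpace ℝ X]
    [FiniteDimensional ℝ X] {K c : ℝ} (hK : 0 < K) (hc : 0 < c) :
    ∃ N : ℕ, ∀ (net : ℤ → Set X),
      (∀ k : ℤ, ∀ x ∈ net k, ∀ y ∈ net k, x ≠ y → (2 : ℝ) ^ (-k) ≤ dist x y) →
      ∀ (P : Finset X) (s : Finset (ℤ × X)), (∀ i ∈ s, i.2 ∈ net i.1 ∧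
        ∃ p ∈ P, ∃ q ∈ P, dist p i.2 ≤ K * 2 ^ (-i.1) ∧ dist q i.2 ≤ K * 2 ^ (-i.1) ∧
          c * 2 ^ (-i.1) ≤ dist p q) → s.card ≤ N * P.card := by
  obtain ⟨M, hM⟩ := exists_card_le_of_separated X (K + c)
  obtain ⟨J, hJ⟩ := exists_card_dyadic_le ((2 * K + c) * (4 / c))
  refine ⟨M * J, fun net hnet P s hs => ?_⟩
  obtain ⟨S, hS⟩ : ∃ S : ℝ, ∀ i ∈ s, c / 4 * (2 : ℝ) ^ (-i.1) ≤ S := by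
    obtain ⟨S, hS⟩ := (s.image fun i => c / 4 * (2 : ℝ) ^ (-i.1)).finite_toSet.bddAbove
    exact ⟨S, fun i hi => hS (Finset.mem_coe.2 (Finset.mem_image_of_mem _ hi))⟩
  obtain ⟨d, hd, hd'⟩ := exists_farthest_point_weights P S
  have key : ∀ i ∈ s, ∃ b ∈ P, c / 4 * (2 : ℝ) ^ (-i.1) ≤ d b ∧
      d b ≤ (2 * K + c) * (2 : ℝ) ^ (-i.1) ∧ dist b i.2 ≤ (K + c) * 2 ^ (-i.1) := by
    intro i hi
    obtain ⟨-, p, hp, q, hq, hpi, hqi, hpq⟩ := hs i hi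
    set ρ : ℝ := 2 ^ (-i.1) with hρ
    have hρ0 : 0 < ρ := by positivity
    have hcρ : 0 < c * ρ := by positivity
    obtain ⟨a, ha, ha1, ha2⟩ := hd' (c / 4 * ρ) (by positivity) (hS i hi) p hp
    obtain ⟨b, hb, hb1, hb2⟩ := hd' (c / 4 * ρ) (by positivity) (hS i hi) q hq
    have tri : dist p q ≤ dist p a + dist a b + dist q b := by
      linarith [dist_triangle4 p a b q, dist_comm b q]
    have hab : a ≠ b := by
      rintro rfl
      rw [dist_self] at tri
      linarith
    have hda : dist a i.2 ≤ (K + c) * ρ := by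
      linarith [dist_triangle_left a i.2 p]
    have hdb : dist b i.2 ≤ (K + c) * ρ := by
      linarith [dist_triangle_left b i.2 q]
    have hab2 : dist a b ≤ (2 * K + c) * ρ := by
      linarith [dist_triangle4 a p i.2 b, dist_triangle_left i.2 b q, dist_comm a p, dist_comm i.2 q,
        dist_triangle i.2 q b, dist_comm q i.2]
    have := (hd a ha b hb hab).trans hab2
    rcases min_le_iff.1 this with h | h
    · exact ⟨a, ha, ha1, h, hda⟩
    · exact ⟨b, hb, hb1, h, hdb⟩
  choose! φ hφ h1 h2 h3 using key
  refine Finset.card_le_mul_card_image_of_maps_to hφ _ fun b hb => ?_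
  set t := s.filter fun i => φ i = b with ht
  have htmem : ∀ i ∈ t, i ∈ s ∧ φ i = b := fun i hi => by simpa [ht] using hi
  have hscales : (t.image Prod.fst).card ≤ J := by
    rcases t.eq_empty_or_nonempty with h | ⟨i, hi⟩
    · simp [h]
    obtain ⟨his, hib⟩ := htmem i hi
    have hdb : 0 < d b := by
      rw [← hib]
      exact lt_of_lt_of_le (by positivity) (h1 i his)
    refine hJ (d b / (2 * K + c)) _ (by positivity) fun k hk => ?_
    obtain ⟨j, hj, rfl⟩ := Finset.mem_image.1 hk
    obtain ⟨hjs, rfl⟩ := htmem j hj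
    refine ⟨by rw [div_le_iff₀' (by positivity)]; exact h2 j hjs, ?_⟩
    have := h1 j hjs
    have e : (2 * K + c) * (4 / c) * (d (φ j) / (2 * K + c)) = 4 / c * d (φ j) := by
      field_simp
    rw [e]
    calc (2 : ℝ) ^ (-j.1) = 4 / c * (c / 4 * 2 ^ (-j.1)) := by field_simp
      _ ≤ _ := by gcongr
  calc t.card ≤ M * (t.image Prod.fst).card := by
        refine Finset.card_le_mul_card_image_of_maps_to
          (fun i hi => Finset.mem_image_of_mem _ hi) _ fun k _ => ?_
        set t' := t.filter fun i => i.1 = k with ht'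
        have htk_mem : ∀ i ∈ t', i ∈ s ∧ φ i = b ∧ i.1 = k := fun i hi => by
          rw [ht', Finset.mem_filter] at hi
          exact ⟨(htmem i hi.1).1, (htmem i hi.1).2, hi.2⟩
        have hinj : Set.InjOn Prod.snd (t' : Set (ℤ × X)) := by
          intro i hi j hj hij
          exact Prod.ext ((htk_mem i hi).2.2.trans (htk_mem j hj).2.2.symm) hij
        rw [← Finset.card_image_of_injOn hinj]
        refine hM b (2 ^ (-k)) _ (by positivity) ?_ ?_
        · intro x hx
          obtain ⟨i, hi, rfl⟩ := Finset.mem_image.1 hx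
          obtain ⟨his, rfl, rfl⟩ := htk_mem i hi
          rw [dist_comm]
          exact h3 i his
        · intro x hx y hy hxy
          obtain ⟨i, hi, rfl⟩ := Finset.mem_image.1 hx
          obtain ⟨j, hj, rfl⟩ := Finset.mem_image.1 hy
          obtain ⟨his, -, hik⟩ := htk_mem i hi
          obtain ⟨hjs, -, hjk⟩ := htk_mem j hj
          exact hnet k _ (hik ▸ (hs i his).1) _ (hjk ▸ (hs j hjs).1) hxy
    _ ≤ M * J := by gcongr

/-- A functional vanishing on a line and realising the distance to it. -/
lemma exists_dual_eq_infDist_line {X : Type*} [NormedAddCommGroup X] [NormedSpace ℝ X]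
    (u ζ : X) :
    ∃ φ : StrongDual ℝ X, ‖φ‖ ≤ 1 ∧ φ u = 0 ∧ φ ζ = infDist ζ (lineThrough 0 u) := by
  set S := Submodule.span ℝ {u}
  obtain ⟨g, hg, hgz⟩ := exists_dual_vector'' ℝ (S.mkQ ζ)
  refine ⟨LinearMap.mkContinuous (g.toLinearMap ∘ₗ S.mkQ) 1 fun x => ?_,
    LinearMap.mkContinuous_norm_le _ zero_le_one _, ?_, ?_⟩
  · calc ‖g (S.mkQ x)‖ ≤ ‖g‖ * ‖S.mkQ x‖ := g.le_opNorm _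
      _ ≤ 1 * ‖x‖ := by
        gcongr
        exact Submodule.Quotient.norm_mk_le S x
  · have : S.mkQ u = 0 := by
      simp [S, Submodule.mem_span_singleton_self]
    simp only [LinearMap.mkContinuous_apply, LinearMap.comp_apply, this]
    exact map_zero g
  · have hS : (S.toAddSubgroup : Set X) = lineThrough 0 u := by
      ext y
      simp only [S, Submodule.coe_toAddSubgroup, SetLike.mem_coe, Submodule.mem_span_singleton,
        lineThrough, mem_ofPred_eq, zero_add]
      exact exists_congr fun t => eq_comm
    rw [← hS]
    exact hgz.trans (QuotientAddGroup.norm_mk (S := S.toAddSubgroup) ζ)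

/-- Slabs `|g u| ≤ ε h` in a ball of the dual space have measure at least of order `h / r`. -/
lemma exists_le_addHaar_slab (X : Type*) [NormedAddCommGroup X] [NormedSpace ℝ X]
    [FiniteDimensional ℝ X] {ε : ℝ} (hε : 0 < ε) :
    ∃ c > 0, ∀ (u : X) (h r : ℝ), 0 < h → h ≤ 2 * r → ‖u‖ ≤ 2 * r →
      ENNReal.ofReal (c * (h / r)) ≤
        (Measure.addHaar : Measure (StrongDual ℝ X)) {g | ‖g‖ ≤ ε ∧ |g u| ≤ ε * h} := by
  have : ProperSpace (StrongDual ℝ X) := FiniteDimensional.proper_real _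
  set μ : Measure (StrongDual ℝ X) := Measure.addHaar
  set B : Set (StrongDual ℝ X) := closedBall 0 (ε / 2) with hB
  have hBfin : μ B ≠ ⊤ := (isCompact_closedBall _ _).measure_lt_top.ne
  have hBpos : 0 < μ B := measure_closedBall_pos _ _ (by positivity)
  refine ⟨(μ B).toReal / 4, div_pos (ENNReal.toReal_pos hBpos.ne' hBfin) (by norm_num), ?_⟩
  intro u h r hh hhr hu
  have hr : 0 < r := by linarith
  set V : Set (StrongDual ℝ X) := {g | ‖g‖ ≤ ε ∧ |g u| ≤ ε * h} with hV
  set S : ℕ → Set (StrongDual ℝ X) := fun j =>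
    {g | ‖g‖ ≤ ε / 2 ∧ ε * h * j ≤ g u + ε * r ∧ g u + ε * r ≤ ε * h * (j + 1)} with hS
  have hSV : ∀ j, μ (S j) ≤ μ V := by
    intro j
    rcases (S j).eq_empty_or_nonempty with he | ⟨g₀, h1, h2, h3⟩
    · simp [he]
    · rw [← measure_preimage_add μ (-g₀) V]
      refine measure_mono fun g hg => ?_
      obtain ⟨h1', h2', h3'⟩ := hg
      refine ⟨?_, ?_⟩
      · calc ‖-g₀ + g‖ ≤ ‖-g₀‖ + ‖g‖ := norm_add_le _ _
          _ ≤ ε := by rw [norm_neg]; linarith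
      · rw [add_apply, neg_apply, abs_le]
        constructor <;> linarith
  set n := ⌊2 * r / h⌋₊ with hn
  have hcov : B ⊆ ⋃ j ∈ Finset.range (n + 1), S j := by
    intro g hg
    have hg' : ‖g‖ ≤ ε / 2 := by simpa [hB] using hg
    have hgu : |g u| ≤ ε * r := by
      calc |g u| ≤ ‖g‖ * ‖u‖ := g.le_opNorm u
        _ ≤ ε / 2 * (2 * r) := by gcongr
        _ = ε * r := by ring
    rw [abs_le] at hgu
    have hnn : 0 ≤ (g u + ε * r) / (ε * h) := div_nonneg (by linarith) (by positivity)
    refine mem_biUnion (x := (⌊(g u + ε * r) / (ε * h)⌋₊ : ℕ)) ?_ ⟨hg', ?_, ?_⟩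
    · rw [Finset.coe_range, mem_Iio, Nat.lt_succ_iff]
      refine Nat.floor_le_floor (R := ℝ) ?_
      calc (g u + ε * r) / (ε * h) ≤ (2 * ε * r) / (ε * h) := by gcongr; linarith
        _ = 2 * r / h := by field_simp
    · rw [mul_comm, ← le_div_iff₀ (by positivity)]
      exact Nat.floor_le hnn
    · have := (Nat.lt_floor_add_one ((g u + ε * r) / (ε * h))).le
      rw [div_le_iff₀ (by positivity)] at this
      linarith
  have hmain : μ B ≤ ENNReal.ofReal (4 * (r / h)) * μ V := by
    calc μ B ≤ ∑ j ∈ Finset.range (n + 1), μ (S j) :=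
          (measure_mono hcov).trans (measure_biUnion_finset_le _ _)
      _ ≤ ∑ _j ∈ Finset.range (n + 1), μ V := Finset.sum_le_sum fun j _ => hSV j
      _ = ((n + 1 : ℕ) : ℝ≥0∞) * μ V := by simp
      _ ≤ ENNReal.ofReal (4 * (r / h)) * μ V := by
        gcongr
        rw [← ENNReal.ofReal_natCast]
        refine ENNReal.ofReal_le_ofReal ?_
        have h1 : (n : ℝ) ≤ 2 * r / h := Nat.floor_le (by positivity)
        have h2 : 1 ≤ 2 * r / h := by rwa [le_div_iff₀ hh, one_mul]
        push_cast
        have : 4 * (r / h) = 2 * r / h + 2 * r / h := by ring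
        linarith
  calc ENNReal.ofReal ((μ B).toReal / 4 * (h / r))
      = ENNReal.ofReal (h / r / 4) * μ B := by
        rw [show (μ B).toReal / 4 * (h / r) = h / r / 4 * (μ B).toReal by ring,
          ENNReal.ofReal_mul (by positivity), ENNReal.ofReal_toReal hBfin]
    _ ≤ ENNReal.ofReal (h / r / 4) * (ENNReal.ofReal (4 * (r / h)) * μ V) := by gcongr
    _ = μ V := by
        rw [← mul_assoc, ← ENNReal.ofReal_mul (by positivity),
          show h / r / 4 * (4 * (r / h)) = 1 by field_simp, ENNReal.ofReal_one, one_mul]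

/-- The hyperplanes `{f = t}`, `‖f‖ ≤ 20`, meeting both of the segments `[a, b]` and `[z, w]`. -/
def hyperplanesMeeting {X : Type*} [NormedAddCommGroup X] [NormedSpace ℝ X] (a b z w : X) :
    Set (StrongDual ℝ X × ℝ) :=
  {q | ‖q.1‖ ≤ 20 ∧ q.2 ∈ uIcc (q.1 a) (q.1 b) ∧ q.2 ∈ uIcc (q.1 z) (q.1 w)}

lemma isClosed_hyperplanesMeeting {X : Type*} [NormedAddCommGroup X] [NormedSpace ℝ X]
    (a b z w : X) : IsClosed (hyperplanesMeeting a b z w) := by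
  have ev : ∀ x : X, Continuous fun q : StrongDual ℝ X × ℝ => q.1 x := fun x => by fun_prop
  have hu : ∀ x y : X, IsClosed {q : StrongDual ℝ X × ℝ | q.2 ∈ uIcc (q.1 x) (q.1 y)} := by
    intro x y
    simp only [uIcc, mem_Icc, ofPred_and]
    exact (isClosed_le ((ev x).min (ev y)) continuous_snd).inter
      (isClosed_le continuous_snd ((ev x).max (ev y)))
  exact (isClosed_le continuous_fst.norm continuous_const).inter ((hu a b).inter (hu z w))

/-- If `z` has distance `h` to the chord `ab` of length comparable to `r`, and `[z, w]` is a segment of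
length `r / 8`, then hyperplanes meeting both segments have measure at least of order `h ^ 2 / r`. -/
lemma exists_le_measure_hyperplanesMeeting (X : Type*) [NormedAddCommGroup X] [NormedSpace ℝ X]
    [FiniteDimensional ℝ X] :
    ∃ c > 0, ∀ (a b z w : X) (r h : ℝ), 0 < r → r / 4 ≤ dist b a → dist b a ≤ 2 * r →
      dist z a ≤ 2 * r → dist w z = r / 8 → 0 < h → h = infDist z (lineThrough a (b - a)) →
      ENNReal.ofReal (c * (h ^ 2 / r)) ≤
        ((Measure.addHaar : Measure (StrongDual ℝ X)).prod volume) (hyperplanesMeeting a b z w) := by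
  have : ProperSpace (StrongDual ℝ X) := FiniteDimensional.proper_real _
  set ε : ℝ := 1 / 1000 with hε
  obtain ⟨c₀, hc₀, hslab⟩ := exists_le_addHaar_slab X (show 0 < ε by norm_num [hε])
  refine ⟨c₀ * ε / 64, by positivity, ?_⟩
  intro a b z w r h hr hab hab' hza hwz hh hhdef
  set μ : Measure (StrongDual ℝ X) := Measure.addHaar
  set u := b - a with hu
  set ζ := z - a with hζ
  set p := w - z with hp
  rw [dist_eq_norm] at hab hab' hza hwz
  have hline : infDist ζ (lineThrough 0 u) = h := by
    rw [hhdef]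
    have : lineThrough a u = (IsometryEquiv.addLeft a) '' lineThrough 0 u := by
      ext y
      simp only [lineThrough, zero_add, mem_ofPred_eq, mem_image, IsometryEquiv.addLeft_apply]
      constructor
      · rintro ⟨t, rfl⟩; exact ⟨_, ⟨t, rfl⟩, rfl⟩
      · rintro ⟨_, ⟨t, rfl⟩, rfl⟩; exact ⟨t, rfl⟩
    rw [this, show z = IsometryEquiv.addLeft a ζ by simp [hζ], infDist_image (IsometryEquiv.isometry _)]
  have h0mem : (0 : X) ∈ lineThrough (0 : X) u := ⟨0, by simp⟩
  have hhζ : h ≤ ‖ζ‖ := by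
    rw [← hline, ← dist_zero_right]; exact infDist_le_dist_of_mem h0mem
  have hh2r : h ≤ 2 * r := hhζ.trans hza
  have hu0 : 0 < ‖u‖ := by linarith
  obtain ⟨φ, hφ, hφu, hφζ⟩ := exists_dual_eq_infDist_line u ζ
  rw [hline] at hφζ
  obtain ⟨ψ, hψ, hψu⟩ := exists_dual_vector'' ℝ u
  obtain ⟨χ, hχ, hχp⟩ := exists_dual_vector'' ℝ p
  simp only [RCLike.ofReal_real_eq_id, id_eq] at hψu hχp
  set s : ℝ := 1 / 2 - ψ ζ / ‖u‖ with hs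
  set f₀ : StrongDual ℝ X := (h / ‖u‖) • ψ + s • φ with hf₀
  have hsabs : |s| ≤ 17 / 2 := by
    have h1 : |ψ ζ| ≤ 2 * r := (ψ.le_of_opNorm_le hψ ζ).trans (by linarith)
    have h2 : |ψ ζ / ‖u‖| ≤ 8 := by
      rw [abs_div, abs_of_pos hu0, div_le_iff₀ hu0]; linarith
    rw [abs_le] at h2 ⊢
    constructor <;> linarith
  have hf₀n : ‖f₀‖ ≤ 17 := by
    calc ‖f₀‖ ≤ ‖(h / ‖u‖) • ψ‖ + ‖s • φ‖ := norm_add_le _ _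
      _ ≤ 8 * 1 + 17 / 2 * 1 := by
        rw [norm_smul, norm_smul, Real.norm_eq_abs, Real.norm_eq_abs, abs_of_pos (by positivity)]
        gcongr
        rw [div_le_iff₀ hu0]; linarith
      _ ≤ 17 := by norm_num
  have hf₀u : f₀ u = h := by
    simp [hf₀, hφu, hψu, div_mul_cancel₀ _ hu0.ne']
  have hf₀ζ : f₀ ζ = h / 2 := by
    simp only [hf₀, add_apply, smul_apply, smul_eq_mul, hφζ, hs]
    ring
  set τ : ℝ := ε * h / 32 with hτ
  set g₁ : StrongDual ℝ X := (ε * h / (2 * r)) • χ with hg₁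
  have hε0 : 0 < ε := by norm_num [hε]
  have hκ : 0 ≤ ε * h / (2 * r) := by positivity
  have hg₁n : ‖g₁‖ ≤ ε := by
    calc ‖g₁‖ = ε * h / (2 * r) * ‖χ‖ := by rw [hg₁, norm_smul, Real.norm_of_nonneg hκ]
      _ ≤ ε * (2 * r) / (2 * r) * 1 := by gcongr
      _ = ε := by field_simp
  have hg₁u : |g₁ u| ≤ ε * h := by
    have h1 : |χ u| ≤ 2 * r := (χ.le_of_opNorm_le hχ u).trans (by linarith)
    calc |g₁ u| = ε * h / (2 * r) * |χ u| := by
          rw [hg₁, smul_apply, smul_eq_mul, abs_mul, abs_of_nonneg hκ]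
      _ ≤ ε * h / (2 * r) * (2 * r) := by gcongr
      _ = ε * h := by field_simp
  have hg₁p : g₁ p = 2 * τ := by
    rw [hg₁, smul_apply, smul_eq_mul, hχp, hwz, hτ]
    field_simp; ring
  set G := hyperplanesMeeting a b z w with hG
  have hGm : MeasurableSet G := (isClosed_hyperplanesMeeting a b z w).measurableSet
  set W : Set (StrongDual ℝ X) := {F | ENNReal.ofReal τ ≤ volume (Prod.mk F ⁻¹' G)} with hW
  have hmem : ∀ g : StrongDual ℝ X, ‖g‖ ≤ 2 * ε → |g u| ≤ 2 * (ε * h) → τ ≤ |(f₀ + g) p| →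
      f₀ + g ∈ W := by
    intro g hgn hgu hgp
    have hgζ : |g ζ| ≤ h / 8 := by
      obtain ⟨y, ⟨t, rfl⟩, ht⟩ := (infDist_lt_iff ⟨0, h0mem⟩).1
        (show infDist ζ (lineThrough 0 u) < 2 * h by rw [hline]; linarith)
      rw [zero_add, dist_eq_norm] at ht
      have ht' : |t| ≤ 24 := by
        have h1 : ‖t • u‖ ≤ ‖ζ‖ + ‖ζ - t • u‖ := by
          calc ‖t • u‖ = ‖ζ - (ζ - t • u)‖ := by congr 1; abel
            _ ≤ _ := norm_sub_le _ _
        rw [norm_smul, Real.norm_eq_abs] at h1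
        by_contra! h2
        have h3 : 24 * (r / 4) ≤ |t| * ‖u‖ := by gcongr
        linarith [mul_lt_mul_of_pos_right h2 hu0]
      have hdec : g ζ = t * g u + g (ζ - t • u) := by
        rw [map_sub g ζ (t • u), map_smul, smul_eq_mul]; ring
      calc |g ζ| ≤ |t| * |g u| + |g (ζ - t • u)| := by
            rw [hdec, ← abs_mul]; exact abs_add_le _ _
        _ ≤ 24 * (2 * (ε * h)) + 2 * ε * (2 * h) := by
            gcongr
            exact (g.le_of_opNorm_le hgn _).trans (by gcongr)
        _ ≤ h / 8 := by rw [hε]; linarith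
    set F := f₀ + g with hF
    have hFn : ‖F‖ ≤ 20 := by
      calc ‖F‖ ≤ ‖f₀‖ + ‖g‖ := norm_add_le _ _
        _ ≤ 20 := by rw [hε] at hgn; linarith
    have hFu : F b - F a = h + g u := by rw [← map_sub, ← hu, hF, add_apply, hf₀u]
    have hFζ : F z - F a = h / 2 + g ζ := by rw [← map_sub, ← hζ, hF, add_apply, hf₀ζ]
    have hFp : F w - F z = F p := by rw [← map_sub]
    have hτh : τ ≤ h / 8 := by rw [hτ, hε]; linarith
    have hτ0 : 0 < τ := by positivity
    rw [abs_le] at hgu hgζ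
    have hεh : 2 * (ε * h) ≤ h / 8 := by rw [hε]; linarith
    show ENNReal.ofReal τ ≤ volume (Prod.mk F ⁻¹' G)
    have hzb : F z + τ ≤ F b := by
      obtain ⟨h1, h2⟩ := hgu
      obtain ⟨h3, h4⟩ := hgζ
      clear_value F τ ε ζ u p
      linarith only [h1, h4, hεh, hFu, hFζ, hτh, hh]
    rcases le_abs.1 hgp with hpos | hneg
    · have hsub : Icc (F z) (F z + τ) ⊆ Prod.mk F ⁻¹' G := by
        rintro t ⟨ht1, ht2⟩
        exact ⟨hFn, mem_uIcc_of_le (show F a ≤ t by linarith) (show t ≤ F b by linarith),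
          mem_uIcc_of_le (show F z ≤ t by linarith) (show t ≤ F w by linarith)⟩
      calc ENNReal.ofReal τ = volume (Icc (F z) (F z + τ)) := by
            rw [Real.volume_Icc]; congr 1; ring
        _ ≤ _ := measure_mono hsub
    · have hsub : Icc (F z - τ) (F z) ⊆ Prod.mk F ⁻¹' G := by
        rintro t ⟨ht1, ht2⟩
        exact ⟨hFn, mem_uIcc_of_le (show F a ≤ t by linarith) (show t ≤ F b by linarith),
          mem_uIcc_of_ge (show F w ≤ t by linarith) (show t ≤ F z by linarith)⟩
      calc ENNReal.ofReal τ = volume (Icc (F z - τ) (F z)) := by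
            rw [Real.volume_Icc]; congr 1; ring
        _ ≤ _ := measure_mono hsub
  have hVW : μ {g | ‖g‖ ≤ ε ∧ |g u| ≤ ε * h} ≤ 2 * μ W := by
    have hsub : {g : StrongDual ℝ X | ‖g‖ ≤ ε ∧ |g u| ≤ ε * h} ⊆
        ((fun g => f₀ + g) ⁻¹' W) ∪ ((fun g => (f₀ + g₁) + g) ⁻¹' W) := by
      rintro g ⟨hgn, hgu⟩
      by_cases hgp : τ ≤ |(f₀ + g) p|
      · left
        have : 0 < ε * h := by positivity
        exact hmem g (by linarith) (by linarith) hgp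
      · right
        show f₀ + g₁ + g ∈ W
        rw [add_assoc]
        refine hmem (g₁ + g) ((norm_add_le _ _).trans (by linarith))
          ((abs_add_le (g₁ u) (g u)).trans (by linarith)) ?_
        have e : (f₀ + (g₁ + g)) p = 2 * τ + (f₀ + g) p := by
          simp only [add_apply, hg₁p]; ring
        rw [e]
        rw [not_le, abs_lt] at hgp
        exact le_trans (by linarith) (le_abs_self _)
    calc _ ≤ μ ((fun g => f₀ + g) ⁻¹' W) + μ ((fun g => (f₀ + g₁) + g) ⁻¹' W) :=
          (measure_mono hsub).trans (measure_union_le _ _)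
      _ = 2 * μ W := by rw [measure_preimage_add, measure_preimage_add, two_mul]
  have hτ0 : 0 < τ := by positivity
  have hmarkov : ENNReal.ofReal τ * μ W ≤ (μ.prod volume) G := by
    rw [Measure.prod_apply hGm]
    exact mul_meas_ge_le_lintegral (measurable_measure_prodMk_left hGm) _
  have hsl := hslab u h r hh hh2r hab'
  calc ENNReal.ofReal (c₀ * ε / 64 * (h ^ 2 / r))
      = ENNReal.ofReal (τ / 2) * ENNReal.ofReal (c₀ * (h / r)) := by
        rw [← ENNReal.ofReal_mul (by positivity)]
        congr 1
        rw [hτ]; field_simp; ring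
    _ ≤ ENNReal.ofReal (τ / 2) * (2 * μ W) := by
        gcongr
        exact hsl.trans hVW
    _ = ENNReal.ofReal τ * μ W := by
        rw [← mul_assoc, ← ENNReal.ofReal_ofNat, ← ENNReal.ofReal_mul (by positivity)]
        congr 2; ring
    _ ≤ _ := hmarkov

/-- A ball in which a connected set is not flat contains a chord of the set and a point of the set,
both joined to separated connected pieces, with the point far from the chord line. -/
lemma exists_separated_arcs {X : Type*} [NormedAddCommGroup X] [NormedSpace ℝ X] {Γ : Set X}
    (hΓ : IsPathConnected Γ) {x y : X} (hx : x ∈ Γ) (hy : y ∈ Γ) {r b : ℝ} (hr : 0 < r)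
    (hxy : r ≤ dist y x) (hb : 0 < b)
    (hflat : ∀ a v : X, v ≠ 0 → ∃ z ∈ Γ, dist z x ≤ r ∧ b ≤ infDist z (lineThrough a v)) :
    ∃ a e z w : X, ∃ α ⊆ Γ, ∃ α' ⊆ Γ, IsPreconnected α ∧ IsPreconnected α' ∧
      a ∈ α ∧ e ∈ α ∧ z ∈ α' ∧ w ∈ α' ∧
      (∀ p ∈ α, dist p x ≤ 2 * r) ∧ (∀ p ∈ α', dist p x ≤ 2 * r) ∧
      (∀ p ∈ α, ∀ q ∈ α', r / 8 ≤ dist p q) ∧ r / 4 ≤ dist e a ∧ dist e a ≤ 2 * r ∧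
      dist z a ≤ 2 * r ∧ dist w z = r / 8 ∧ b / 40 ≤ infDist z (lineThrough a (e - a)) := by
  have finish : ∀ (a e z : X) (α : Set X), α ⊆ Γ → IsPreconnected α → a ∈ α → e ∈ α → z ∈ Γ →
      (∀ p ∈ α, dist p x ≤ r) → dist z x ≤ r → (∀ p ∈ α, r / 4 ≤ dist p z) → r / 4 ≤ dist e a →
      b / 40 ≤ infDist z (lineThrough a (e - a)) →
      ∃ a e z w : X, ∃ α ⊆ Γ, ∃ α' ⊆ Γ, IsPreconnected α ∧ IsPreconnected α' ∧
      a ∈ α ∧ e ∈ α ∧ z ∈ α' ∧ w ∈ α' ∧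
      (∀ p ∈ α, dist p x ≤ 2 * r) ∧ (∀ p ∈ α', dist p x ≤ 2 * r) ∧
      (∀ p ∈ α, ∀ q ∈ α', r / 8 ≤ dist p q) ∧ r / 4 ≤ dist e a ∧ dist e a ≤ 2 * r ∧
      dist z a ≤ 2 * r ∧ dist w z = r / 8 ∧ b / 40 ≤ infDist z (lineThrough a (e - a)) := by
    intro a e z α hαΓ hα ha he hz hαx hzx hαz hea hzl
    obtain ⟨q, hq, hqz⟩ : ∃ q ∈ Γ, r / 8 ≤ dist q z := by
      by_cases h : r / 8 ≤ dist x z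
      · exact ⟨x, hx, h⟩
      · exact ⟨y, hy, by linarith [dist_triangle y z x, dist_comm x z]⟩
    obtain ⟨α', hα'Γ, hα', ⟨z', hz', hz'0⟩, ⟨w, hw, hwz⟩, hα'b⟩ :=
      exists_arc_across_annulus hΓ hz hq le_rfl (by positivity) hqz
    obtain rfl : z' = z := dist_eq_zero.1 hz'0
    refine ⟨a, e, z', w, α, hαΓ, α', hα'Γ, hα, hα', ha, he, hz', hw, ?_, ?_, ?_, hea, ?_, ?_, hwz,
      hzl⟩
    · intro p hp; linarith [hαx p hp]
    · intro p hp; linarith [(hα'b p hp).2, dist_triangle p z' x]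
    · intro p hp q hq
      linarith [hαz p hp, (hα'b q hq).2, dist_triangle p q z']
    · linarith [hαx a ha, hαx e he, dist_triangle_right e a x]
    · linarith [hαx a ha, dist_triangle_right z' a x]
  obtain ⟨α₁, hα₁Γ, hα₁, ⟨x₁, hx₁, hx₁0⟩, ⟨y₁, hy₁, hy₁x⟩, hα₁b⟩ :=
    exists_arc_across_annulus hΓ hx hy le_rfl (show 0 ≤ r / 4 by positivity) (by linarith)
  obtain ⟨α₂, hα₂Γ, hα₂, ⟨x₂, hx₂, hx₂x⟩, ⟨y₂, hy₂, hy₂x⟩, hα₂b⟩ :=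
    exists_arc_across_annulus hΓ hx hy (show 0 ≤ 3 * r / 4 by positivity)
      (show 3 * r / 4 ≤ r by linarith) hxy
  obtain rfl : x₁ = x := dist_eq_zero.1 hx₁0
  have hxy₂ : r / 4 ≤ dist y₂ x₂ := by linarith [dist_triangle y₂ x₂ x₁]
  by_cases h₁ : ∃ z ∈ Γ, dist z x₁ ≤ r ∧ r / 2 ≤ dist z x₁ ∧
      b / 40 ≤ infDist z (lineThrough x₁ (y₁ - x₁))
  · obtain ⟨z, hz, hzr, hzr', hzl⟩ := h₁
    refine finish x₁ y₁ z α₁ hα₁Γ hα₁ hx₁ hy₁ hz (fun p hp => by linarith [(hα₁b p hp).2]) hzr ?_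
      hy₁x.ge hzl
    intro p hp
    linarith [(hα₁b p hp).2, dist_triangle_left z x₁ p]
  by_cases h₂ : ∃ z ∈ Γ, dist z x₁ ≤ r / 2 ∧ b / 40 ≤ infDist z (lineThrough x₂ (y₂ - x₂))
  · obtain ⟨z, hz, hzr, hzl⟩ := h₂
    refine finish x₂ y₂ z α₂ hα₂Γ hα₂ hx₂ hy₂ hz (fun p hp => (hα₂b p hp).2) (by linarith) ?_
      hxy₂ hzl
    intro p hp
    linarith [(hα₂b p hp).1, dist_triangle p z x₁]
  exfalso
  push Not at h₁ h₂
  have hmem : ∀ a v : X, (lineThrough a v).Nonempty := fun a v => ⟨a, 0, by simp⟩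
  have hy₁ne : y₁ - x₁ ≠ 0 := by
    rw [← norm_pos_iff, ← dist_eq_norm, hy₁x]; positivity
  obtain ⟨z, hz, hzr, hzl⟩ := hflat x₁ (y₁ - x₁) hy₁ne
  have hbr : b ≤ r := hzl.trans ((infDist_le_dist_of_mem
    (show x₁ ∈ lineThrough x₁ (y₁ - x₁) from ⟨0, by simp⟩)).trans hzr)
  have hz2 : dist z x₁ ≤ r / 2 := by
    by_contra! h
    linarith [h₁ z hz hzr h.le]
  obtain ⟨_, ⟨s, rfl⟩, hs⟩ := (infDist_lt_iff (hmem _ _)).1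
    (h₁ x₂ (hα₂Γ hx₂) (by linarith) (by linarith))
  obtain ⟨_, ⟨s', rfl⟩, hs'⟩ := (infDist_lt_iff (hmem _ _)).1
    (h₁ y₂ (hα₂Γ hy₂) (by linarith) (by linarith))
  obtain ⟨_, ⟨t, rfl⟩, ht⟩ := (infDist_lt_iff (hmem _ _)).1 (h₂ z hz hz2)
  have htabs : |t| ≤ 12 := by
    have h3 : |t| * dist y₂ x₂ ≤ 3 * r := by
      calc |t| * dist y₂ x₂ = dist (x₂ + t • (y₂ - x₂)) x₂ := by
            rw [dist_eq_norm, dist_eq_norm, add_sub_cancel_left, norm_smul, Real.norm_eq_abs]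
        _ ≤ dist z (x₂ + t • (y₂ - x₂)) + dist z x₂ := dist_triangle_left _ _ _
        _ ≤ 3 * r := by linarith [dist_triangle_right z x₂ x₁]
    by_contra! h
    have : 12 * (r / 4) < |t| * dist y₂ x₂ := by
      apply mul_lt_mul h hxy₂ (by positivity) (by positivity)
    linarith
  rw [dist_eq_norm] at hs hs' ht
  set v := y₁ - x₁ with hv
  have hle : infDist z (lineThrough x₁ v) ≤ dist z (x₁ + (s + t * (s' - s)) • v) :=
    infDist_le_dist_of_mem ⟨_, rfl⟩
  have hdec : z - (x₁ + (s + t * (s' - s)) • v) = (z - (x₂ + t • (y₂ - x₂))) +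
      ((1 - t) • (x₂ - (x₁ + s • v)) + t • (y₂ - (x₁ + s' • v))) := by
    module
  have h1t : |1 - t| ≤ 13 := by
    rw [abs_le] at htabs ⊢
    constructor <;> linarith
  have hn : dist z (x₁ + (s + t * (s' - s)) • v) ≤ b / 40 + (13 * (b / 40) + 12 * (b / 40)) := by
    rw [dist_eq_norm, hdec]
    refine (norm_add_le _ _).trans (add_le_add ht.le ((norm_add_le _ _).trans (add_le_add ?_ ?_)))
    · rw [norm_smul, Real.norm_eq_abs]; gcongr
    · rw [norm_smul, Real.norm_eq_abs]; gcongr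
  linarith

lemma jonesBeta_nonneg {X : Type*} [NormedAddCommGroup X] [NormedSpace ℝ X] (E Q : Set X) :
    0 ≤ jonesBeta E Q := by
  unfold jonesBeta
  split_ifs
  · exact le_rfl
  · refine Real.sInf_nonneg ?_
    rintro _ ⟨a, v, -, rfl⟩
    refine Real.sSup_nonneg ?_
    rintro _ ⟨z, -, rfl⟩
    exact div_nonneg infDist_nonneg diam_nonneg

lemma jonesBeta_le {X : Type*} [NormedAddCommGroup X] [NormedSpace ℝ X] {E : Set X} {x a v : X}
    {r D : ℝ} (hr : 0 < r) (hD : 0 ≤ D) (hv : v ≠ 0)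
    (h : ∀ z ∈ E, dist z x ≤ r → infDist z (lineThrough a v) ≤ D) :
    jonesBeta E (closedBall x r) ≤ D / (2 * r) := by
  have : Nontrivial X := ⟨v, 0, hv⟩
  unfold jonesBeta
  split_ifs
  · positivity
  · refine le_trans (csInf_le (a := sSup ((fun x' => infDist x' (lineThrough a v) /
      Metric.diam (closedBall x r)) '' (E ∩ closedBall x r))) ⟨0, ?_⟩ ?_)
      (Real.sSup_le ?_ (by positivity))
    · rintro _ ⟨a, v, -, rfl⟩
      refine Real.sSup_nonneg ?_
      rintro _ ⟨z, -, rfl⟩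
      exact div_nonneg infDist_nonneg diam_nonneg
    · exact ⟨a, v, hv, rfl⟩
    · rintro _ ⟨z, hz, rfl⟩
      simp only
      rw [Metric.diam_closedBall_eq x hr.le]
      gcongr
      exact h z hz.1 hz.2

lemma exists_far_from_line {X : Type*} [NormedAddCommGroup X] [NormedSpace ℝ X] {E : Set X}
    {x a v : X} {r : ℝ} (hr : 0 < r) (hv : v ≠ 0) (hβ : 0 < jonesBeta E (closedBall x r)) :
    ∃ z ∈ E, dist z x ≤ r ∧ jonesBeta E (closedBall x r) * r ≤ infDist z (lineThrough a v) := by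
  by_contra! h
  have := jonesBeta_le hr (by positivity) hv fun z hz hzr => (h z hz hzr).le
  have e : jonesBeta E (closedBall x r) * r / (2 * r) = jonesBeta E (closedBall x r) / 2 := by
    field_simp
  linarith

lemma IsPreconnected.exists_dual_eq {X : Type*} [NormedAddCommGroup X] [NormedSpace ℝ X]
    {α : Set X} (hα : IsPreconnected α) {a b : X} (ha : a ∈ α) (hb : b ∈ α) (F : StrongDual ℝ X)
    {t : ℝ} (ht : t ∈ uIcc (F a) (F b)) : ∃ p ∈ α, F p = t :=
  (hα.image F F.continuous.continuousOn).ordConnected.uIcc_subset (mem_image_of_mem F ha)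
    (mem_image_of_mem F hb) ht

/-- Hyperplanes meeting a connected set at two separated points of a ball have measure at least
of order `β ^ 2 * r`. -/
lemma exists_jonesBeta_le_measure (X : Type*) [NormedAddCommGroup X] [NormedSpace ℝ X]
    [FiniteDimensional ℝ X] :
    ∃ C : ℝ, 0 < C ∧ ∀ (Γ E : Set X) (x y : X) (r : ℝ), IsPathConnected Γ → E ⊆ Γ → x ∈ Γ → y ∈ Γ →
      0 < r → r ≤ dist y x → ∃ G : Set (StrongDual ℝ X × ℝ), MeasurableSet G ∧
        ENNReal.ofReal (jonesBeta E (closedBall x r) ^ 2 * (2 * r)) ≤ ENNReal.ofReal C *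
          ((Measure.addHaar : Measure (StrongDual ℝ X)).prod volume) G ∧
        ∀ q ∈ G, ‖q.1‖ ≤ 20 ∧ ∃ p ∈ Γ, ∃ p' ∈ Γ, q.1 p = q.2 ∧ q.1 p' = q.2 ∧
          dist p x ≤ 2 * r ∧ dist p' x ≤ 2 * r ∧ r / 8 ≤ dist p p' := by
  obtain ⟨c, hc, hmeas⟩ := exists_le_measure_hyperplanesMeeting X
  refine ⟨3200 / c, by positivity, ?_⟩
  intro Γ E x y r hΓ hE hx hy hr hxy
  rcases (jonesBeta_nonneg E (closedBall x r)).eq_or_lt with h0 | hβ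
  · exact ⟨∅, MeasurableSet.empty, by simp [← h0], by simp⟩
  set β := jonesBeta E (closedBall x r) with hβdef
  obtain ⟨a, e, z, w, α, hαΓ, α', hα'Γ, hα, hα', ha, he, hz, hw, hαx, hα'x, hsep, hea, hea', hza,
    hwz, hzl⟩ := exists_separated_arcs hΓ hx hy hr hxy (show 0 < β * r by positivity) fun a v hv => by
      obtain ⟨z, hz, h1, h2⟩ := exists_far_from_line (a := a) hr hv hβ
      exact ⟨z, hE hz, h1, h2⟩
  refine ⟨hyperplanesMeeting a e z w, (isClosed_hyperplanesMeeting a e z w).measurableSet, ?_, ?_⟩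
  · set h := infDist z (lineThrough a (e - a))
    have hh : 0 < h := lt_of_lt_of_le (by positivity) hzl
    refine le_trans ?_ (mul_le_mul_right (hmeas a e z w r h hr hea hea' hza hwz hh rfl) _)
    rw [← ENNReal.ofReal_mul (by positivity)]
    refine ENNReal.ofReal_le_ofReal ?_
    calc β ^ 2 * (2 * r) = 3200 / c * (c * ((β * r / 40) ^ 2 / r)) := by field_simp; norm_num
      _ ≤ 3200 / c * (c * (h ^ 2 / r)) := by gcongr
  · rintro q ⟨hq1, hq2, hq3⟩
    obtain ⟨p, hp, hpt⟩ := hα.exists_dual_eq ha he q.1 hq2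
    obtain ⟨p', hp', hpt'⟩ := hα'.exists_dual_eq hz hw q.1 hq3
    exact ⟨hq1, p, hαΓ hp, p', hα'Γ hp', hpt, hpt', hαx p hp, hα'x p' hp', hsep p hp p' hp'⟩

lemma IsPreconnected.ofReal_le_hausdorffMeasure_inter_ball {X : Type*} [MetricSpace X]
    [MeasurableSpace X] [BorelSpace X] {Γ : Set X} (hΓ : IsPreconnected Γ) {p q : X} (hp : p ∈ Γ)
    (hq : q ∈ Γ) {ρ : ℝ} (h : ρ ≤ dist q p) : ENNReal.ofReal ρ ≤ μH[1] (Γ ∩ ball p ρ) := by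
  have hlip : LipschitzWith 1 fun z => dist z p := LipschitzWith.dist_left p
  have hsub : Ico 0 ρ ⊆ (fun z => dist z p) '' (Γ ∩ ball p ρ) := by
    intro t ht
    obtain ⟨z, hz, rfl⟩ := (hΓ.image _ hlip.continuous.continuousOn).ordConnected.out
      (mem_image_of_mem _ hp) (mem_image_of_mem _ hq) (show t ∈ Icc (dist p p) (dist q p) from
        ⟨by simpa using ht.1, ht.2.le.trans h⟩)
    exact ⟨z, ⟨hz, ht.2⟩, rfl⟩
  calc ENNReal.ofReal ρ = μH[1] (Ico 0 ρ) := by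
        rw [hausdorffMeasure_real, Real.volume_Ico, sub_zero]
    _ ≤ μH[1] ((fun z => dist z p) '' (Γ ∩ ball p ρ)) := measure_mono hsub
    _ ≤ μH[1] (Γ ∩ ball p ρ) := by simpa using hlip.hausdorffMeasure_image_le zero_le_one _

lemma IsPreconnected.ofReal_diam_le_hausdorffMeasure {X : Type*} [MetricSpace X]
    [MeasurableSpace X] [BorelSpace X] {Γ E : Set X} (hΓ : IsPreconnected Γ) (hE : E ⊆ Γ) :
    ENNReal.ofReal (Metric.diam E) ≤ μH[1] Γ := by
  by_cases htop : μH[1] Γ = ⊤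
  · simp [htop]
  refine ENNReal.ofReal_le_of_le_toReal
    (Metric.diam_le_of_forall_dist_le ENNReal.toReal_nonneg fun q hq p hp => ?_)
  refine (ENNReal.ofReal_le_iff_le_toReal htop).1 ?_
  exact (hΓ.ofReal_le_hausdorffMeasure_inter_ball (hE hp) (hE hq) le_rfl).trans
    (measure_mono inter_subset_left)

lemma exists_net_card_mul_le_hausdorffMeasure {X : Type*} [MetricSpace X]
    [MeasurableSpace X] [BorelSpace X] {Γ : Set X} (hΓ : IsPreconnected Γ) (hcl : IsClosed Γ)
    (htop : μH[1] Γ ≠ ⊤) {δ : ℝ} (hδ : 0 < δ) (hbig : ∀ p ∈ Γ, ∃ q ∈ Γ, δ / 2 ≤ dist q p) :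
    ∃ P : Finset X, (∀ p ∈ Γ, ∃ n ∈ P, dist p n < δ) ∧
      P.card * ENNReal.ofReal (δ / 2) ≤ μH[1] Γ := by
  let sep : Finset X → Prop := fun P => ↑P ⊆ Γ ∧ ∀ p ∈ P, ∀ q ∈ P, p ≠ q → δ ≤ dist p q
  have hcard : ∀ P, sep P → P.card * ENNReal.ofReal (δ / 2) ≤ μH[1] Γ := by
    intro P hP
    calc (P.card : ℝ≥0∞) * ENNReal.ofReal (δ / 2) = ∑ _p ∈ P, ENNReal.ofReal (δ / 2) := by simp
      _ ≤ ∑ p ∈ P, μH[1] (Γ ∩ ball p (δ / 2)) := by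
        refine Finset.sum_le_sum fun p hp => ?_
        obtain ⟨q, hq, hqp⟩ := hbig p (hP.1 hp)
        exact hΓ.ofReal_le_hausdorffMeasure_inter_ball (hP.1 hp) hq hqp
      _ = μH[1] (⋃ p ∈ P, Γ ∩ ball p (δ / 2)) := by
        refine (measure_biUnion_finset ?_ fun p _ =>
          hcl.measurableSet.inter measurableSet_ball).symm
        intro p hp q hq hpq
        refine Disjoint.mono inter_subset_right inter_subset_right (ball_disjoint_ball ?_)
        linarith [hP.2 p hp q hq hpq]
      _ ≤ μH[1] Γ := measure_mono (iUnion₂_subset fun p _ => inter_subset_left)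
  have hbdd : BddAbove {n | ∃ P, sep P ∧ P.card = n} := by
    refine ⟨⌊(μH[1] Γ).toReal / (δ / 2)⌋₊, ?_⟩
    rintro _ ⟨P, hP, rfl⟩
    refine Nat.le_floor ?_
    rw [le_div_iff₀ (by positivity)]
    have := ENNReal.toReal_mono htop (hcard P hP)
    rwa [ENNReal.toReal_mul, ENNReal.toReal_natCast, ENNReal.toReal_ofReal (by positivity)] at this
  have hne : {n | ∃ P, sep P ∧ P.card = n}.Nonempty := ⟨0, ∅, by simp [sep], rfl⟩
  obtain ⟨P, hP, hPmax⟩ := Nat.sSup_mem hne hbdd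
  refine ⟨P, fun p hp => ?_, hcard P hP⟩
  by_contra! h
  have hpP : p ∉ P := fun h' => by simpa using hδ.trans_le (h p h')
  suffices hsep : sep (insert p P) by
    have hle := le_csSup hbdd ⟨insert p P, hsep, rfl⟩
    rw [Finset.card_insert_of_notMem hpP] at hle
    omega
  refine ⟨?_, ?_⟩
  · simpa [insert_subset_iff, hp] using hP.1
  · intro a ha b hb hab
    rcases Finset.mem_insert.1 ha with rfl | ha' <;> rcases Finset.mem_insert.1 hb with rfl | hb'
    · exact absurd rfl hab
    · exact h b hb'
    · rw [dist_comm]; exact h a ha'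
    · exact hP.2 a ha' b hb' hab

/-- The pairs `(F, t)` with `‖F‖ ≤ 20` whose hyperplane `F = t` nearly passes through `p`. -/
def hyperplanesNear {X : Type*} [NormedAddCommGroup X] [NormedSpace ℝ X] (p : X) (ε : ℝ) :
    Set (StrongDual ℝ X × ℝ) :=
  {q | ‖q.1‖ ≤ 20 ∧ |q.1 p - q.2| ≤ ε}

lemma isClosed_hyperplanesNear {X : Type*} [NormedAddCommGroup X] [NormedSpace ℝ X] (p : X)
    (ε : ℝ) : IsClosed (hyperplanesNear p ε) := by
  have h : Continuous fun q : StrongDual ℝ X × ℝ => q.1 p - q.2 := by fun_prop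
  exact (isClosed_le continuous_fst.norm continuous_const).inter (isClosed_le h.abs continuous_const)

lemma measure_hyperplanesNear_le {X : Type*} [NormedAddCommGroup X] [NormedSpace ℝ X]
    [FiniteDimensional ℝ X] (p : X) (ε : ℝ) :
    ((Measure.addHaar : Measure (StrongDual ℝ X)).prod volume) (hyperplanesNear p ε) ≤
      ENNReal.ofReal (2 * ε) * Measure.addHaar (closedBall (0 : StrongDual ℝ X) 20) := by
  have : ProperSpace (StrongDual ℝ X) := FiniteDimensional.proper_real _
  rw [Measure.prod_apply (isClosed_hyperplanesNear p ε).measurableSet,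
    ← lintegral_indicator_const isClosed_closedBall.measurableSet]
  refine lintegral_mono fun F => ?_
  by_cases hF : F ∈ closedBall (0 : StrongDual ℝ X) 20
  · rw [indicator_of_mem hF, ← Real.volume_closedBall (F p)]
    refine measure_mono fun t ht => ?_
    rw [mem_closedBall, dist_comm, Real.dist_eq]
    exact ht.2
  · rw [indicator_of_notMem hF]
    refine (measure_mono_null (t := ∅) (fun t ht => hF ?_) measure_empty).le
    simpa using ht.1

lemma exists_sum_jonesBeta_le_of_not_covered (X : Type*) [NormedAddCommGroup X] [NormedSpace ℝ X]
    [FiniteDimensional ℝ X] [MeasurableSpace X] [BorelSpace X] {A : ℝ} (hA : 1 < A) :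
    ∃ C : ℝ≥0∞, C ≠ ⊤ ∧ ∀ (Γ E : Set X) (net : ℤ → Set X), IsPathConnected Γ → IsClosed Γ →
      μH[1] Γ ≠ ⊤ → E ⊆ Γ → IsPartialMultiresolution E net → ∀ s : Finset (ℤ × X),
      (∀ i ∈ s, i.2 ∈ net i.1 ∧ ∃ y ∈ Γ, A * (2 : ℝ) ^ (-i.1) ≤ dist y i.2) →
      ∑ i ∈ s, ENNReal.ofReal (jonesBeta E (closedBall i.2 (A * (2 : ℝ) ^ (-i.1))) ^ 2 *
        (2 * (A * (2 : ℝ) ^ (-i.1)))) ≤ C * μH[1] Γ := by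
  have : ProperSpace (StrongDual ℝ X) := FiniteDimensional.proper_real _
  obtain ⟨C, hC, hβ⟩ := exists_jonesBeta_le_measure X
  obtain ⟨N, hN⟩ := exists_card_spread_balls_le X (K := 3 * A) (c := A / 16) (by positivity)
    (by positivity)
  set m := (Measure.addHaar : Measure (StrongDual ℝ X)).prod (volume : Measure ℝ)
  set V := Measure.addHaar (closedBall (0 : StrongDual ℝ X) 20)
  have hV : V ≠ ⊤ := measure_closedBall_lt_top.ne
  refine ⟨ENNReal.ofReal C * (N * (80 * V)), by finiteness, ?_⟩
  intro Γ E net hΓ hcl htop hE hnet s hs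
  rcases s.eq_empty_or_nonempty with rfl | hne
  · simp
  have hx : ∀ i ∈ s, i.2 ∈ Γ := fun i hi => hE (hnet.1 _ (hs i hi).1)
  have hr : ∀ i : ℤ × X, 0 < A * (2 : ℝ) ^ (-i.1) := fun i => by positivity
  obtain ⟨δ, hδ, hδs⟩ : ∃ δ : ℝ, 0 < δ ∧ ∀ i ∈ s, 32 * δ ≤ A * (2 : ℝ) ^ (-i.1) := by
    obtain ⟨i₀, -, hmin⟩ := s.exists_min_image (fun i => A * (2 : ℝ) ^ (-i.1)) hne
    refine ⟨A * (2 : ℝ) ^ (-i₀.1) / 32, by have := hr i₀; positivity, fun i hi => ?_⟩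
    linarith [hmin i hi]
  obtain ⟨P, hPnet, hPcard⟩ := exists_net_card_mul_le_hausdorffMeasure
      hΓ.isConnected.isPreconnected hcl htop hδ (by
    intro p hp
    obtain ⟨i, hi⟩ := hne
    obtain ⟨-, y, hy, hyx⟩ := hs i hi
    have := hδs i hi
    by_cases h : δ / 2 ≤ dist y p
    · exact ⟨y, hy, h⟩
    · exact ⟨i.2, hx i hi, by linarith [dist_triangle y p i.2, dist_comm p i.2]⟩)
  have hex : ∀ i : ℤ × X, ∃ G : Set (StrongDual ℝ X × ℝ), i ∈ s → MeasurableSet G ∧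
      ENNReal.ofReal (jonesBeta E (closedBall i.2 (A * (2 : ℝ) ^ (-i.1))) ^ 2 *
        (2 * (A * (2 : ℝ) ^ (-i.1)))) ≤ ENNReal.ofReal C * m G ∧
      ∀ q ∈ G, ∃ p ∈ P, ∃ p' ∈ P, q ∈ hyperplanesNear p (20 * δ) ∧
        q ∈ hyperplanesNear p' (20 * δ) ∧ dist p i.2 ≤ 3 * A * (2 : ℝ) ^ (-i.1) ∧
        dist p' i.2 ≤ 3 * A * (2 : ℝ) ^ (-i.1) ∧ A / 16 * (2 : ℝ) ^ (-i.1) ≤ dist p p' := by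
    intro i
    by_cases hi : i ∈ s
    swap
    · exact ⟨∅, fun h => absurd h hi⟩
    obtain ⟨-, y, hy, hyx⟩ := hs i hi
    obtain ⟨G, hG, hGm, hGq⟩ := hβ Γ E i.2 y _ hΓ hE (hx i hi) hy (hr i) hyx
    refine ⟨G, fun _ => ⟨hG, hGm, fun q hq => ?_⟩⟩
    obtain ⟨hq1, p, hp, p', hp', hpt, hpt', hpx, hpx', hpp⟩ := hGq q hq
    obtain ⟨n, hn, hpn⟩ := hPnet p hp
    obtain ⟨n', hn', hpn'⟩ := hPnet p' hp'
    have hδi := hδs i hi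
    have near : ∀ a b : X, dist a b < δ → q.1 a = q.2 → q ∈ hyperplanesNear b (20 * δ) := by
      intro a b hab hat
      refine ⟨hq1, ?_⟩
      rw [← hat, ← map_sub, ← Real.norm_eq_abs]
      refine (q.1.le_opNorm _).trans ?_
      rw [← dist_eq_norm, dist_comm]
      gcongr
    refine ⟨n, hn, n', hn', near p n hpn hpt, near p' n' hpn' hpt', ?_, ?_, ?_⟩
    · linarith [dist_triangle_left n i.2 p]
    · linarith [dist_triangle_left n' i.2 p']
    · linarith [dist_triangle4 p n n' p', dist_comm n' p']
  choose G hG using hex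
  have hpt : ∀ q : StrongDual ℝ X × ℝ, ∑ i ∈ s, (G i).indicator (1 : StrongDual ℝ X × ℝ → ℝ≥0∞) q ≤
      N * ∑ p ∈ P, (hyperplanesNear p (20 * δ)).indicator
        (1 : StrongDual ℝ X × ℝ → ℝ≥0∞) q := by
    intro q
    simp only [indicator_apply, Pi.one_apply, Finset.sum_boole]
    have := hN net hnet.2.2 (P.filter fun p => q ∈ hyperplanesNear p (20 * δ))
      (s.filter fun i => q ∈ G i) (by
        intro i hi
        rw [Finset.mem_filter] at hi
        obtain ⟨p, hp, p', hp', h1, h2, h3⟩ := (hG i hi.1).2.2 q hi.2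
        exact ⟨(hs i hi.1).1, p, Finset.mem_filter.2 ⟨hp, h1⟩, p', Finset.mem_filter.2 ⟨hp', h2⟩,
          h3⟩)
    exact_mod_cast this
  calc _ ≤ ∑ i ∈ s, ENNReal.ofReal C * m (G i) := Finset.sum_le_sum fun i hi => (hG i hi).2.1
    _ = ENNReal.ofReal C * ∑ i ∈ s, ∫⁻ q, (G i).indicator 1 q ∂m := by
      rw [← Finset.mul_sum]
      congr 1
      exact Finset.sum_congr rfl fun i hi => (lintegral_indicator_one (hG i hi).1).symm
    _ = ENNReal.ofReal C * ∫⁻ q, ∑ i ∈ s, (G i).indicator 1 q ∂m := by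
      rw [lintegral_finsetSum s fun i hi => measurable_one.indicator (hG i hi).1]
    _ ≤ ENNReal.ofReal C * ∫⁻ q, N * ∑ p ∈ P, (hyperplanesNear p (20 * δ)).indicator 1 q ∂m := by
      gcongr with q
      exact hpt q
    _ = ENNReal.ofReal C * (N * ∑ p ∈ P, m (hyperplanesNear p (20 * δ))) := by
      rw [lintegral_const_mul' _ _ (by finiteness), lintegral_finsetSum P fun p _ =>
        measurable_one.indicator (isClosed_hyperplanesNear p _).measurableSet]
      congr 2
      exact Finset.sum_congr rfl fun p _ =>
        lintegral_indicator_one (isClosed_hyperplanesNear p _).measurableSet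
    _ ≤ ENNReal.ofReal C * (N * ∑ p ∈ P, ENNReal.ofReal (2 * (20 * δ)) * V) := by
      gcongr with p
      exact measure_hyperplanesNear_le p _
    _ = ENNReal.ofReal C * (N * (80 * V)) * (P.card * ENNReal.ofReal (δ / 2)) := by
      have : ENNReal.ofReal (2 * (20 * δ)) = 80 * ENNReal.ofReal (δ / 2) := by
        rw [show 2 * (20 * δ) = 80 * (δ / 2) by ring, ENNReal.ofReal_mul (by norm_num)]
        norm_num
      rw [Finset.sum_const, nsmul_eq_mul, this]
      ring
    _ ≤ _ := by gcongr

lemma sum_two_zpow_le {t : Finset ℤ} {Y : ℝ} (hY : 0 ≤ Y) (h : ∀ k ∈ t, (2 : ℝ) ^ k ≤ Y) :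
    ∑ k ∈ t, (2 : ℝ) ^ k ≤ 2 * Y := by
  induction t using Finset.induction_on_max generalizing Y with
  | empty => simpa using hY
  | insert a t hlt ih =>
    rw [Finset.sum_insert fun ha => (hlt a ha).false]
    have h1 := ih (Y := 2 ^ (a - 1)) (by positivity) fun k hk =>
      zpow_le_zpow_right₀ one_le_two (by have := hlt k hk; omega)
    have h2 := h a (Finset.mem_insert_self _ _)
    have h3 : 2 * (2 : ℝ) ^ (a - 1) = 2 ^ a := by
      rw [zpow_sub_one₀ two_ne_zero]; ring
    linarith

lemma exists_sum_jonesBeta_le_of_covered (X : Type*) [NormedAddCommGroup X] [NormedSpace ℝ X]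
    [FiniteDimensional ℝ X] [Nontrivial X] [MeasurableSpace X] [BorelSpace X] {A : ℝ} (hA : 1 < A) :
    ∃ C : ℝ≥0∞, C ≠ ⊤ ∧ ∀ (Γ E : Set X) (net : ℤ → Set X), IsPreconnected Γ → IsBounded Γ →
      E ⊆ Γ → IsPartialMultiresolution E net → ∀ s : Finset (ℤ × X),
      (∀ i ∈ s, i.2 ∈ net i.1 ∧ ∀ y ∈ Γ, dist y i.2 ≤ A * (2 : ℝ) ^ (-i.1)) →
      ∑ i ∈ s, ENNReal.ofReal (jonesBeta E (closedBall i.2 (A * (2 : ℝ) ^ (-i.1))) ^ 2 *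
        (2 * (A * (2 : ℝ) ^ (-i.1)))) ≤ C * μH[1] Γ := by
  obtain ⟨M, hM⟩ := exists_card_le_of_separated X A
  obtain ⟨v, hv⟩ := exists_ne (0 : X)
  refine ⟨ENNReal.ofReal (2 * M), by finiteness, ?_⟩
  intro Γ E net hΓ hbdd hE hnet s hs
  have hx : ∀ i ∈ s, i.2 ∈ Γ := fun i hi => hE (hnet.1 _ (hs i hi).1)
  have hr : ∀ i : ℤ × X, 0 < A * (2 : ℝ) ^ (-i.1) := fun i => by positivity
  set D := Metric.diam Γ
  have hD0 : 0 ≤ D := diam_nonneg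
  have hterm : ∀ i ∈ s, jonesBeta E (closedBall i.2 (A * (2 : ℝ) ^ (-i.1))) ^ 2 *
      (2 * (A * (2 : ℝ) ^ (-i.1))) ≤ D ^ 2 / (2 * A) * 2 ^ i.1 := by
    intro i hi
    have hβ : jonesBeta E (closedBall i.2 (A * (2 : ℝ) ^ (-i.1))) ≤
        D / (2 * (A * (2 : ℝ) ^ (-i.1))) := by
      refine jonesBeta_le (hr i) hD0 hv (a := i.2) fun z hz _ => ?_
      exact (infDist_le_dist_of_mem (show i.2 ∈ lineThrough i.2 v from ⟨0, by simp⟩)).trans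
        (dist_le_diam_of_mem hbdd (hE hz) (hx i hi))
    have hβ0 := jonesBeta_nonneg E (closedBall i.2 (A * (2 : ℝ) ^ (-i.1)))
    have hri := hr i
    calc _ ≤ (D / (2 * (A * (2 : ℝ) ^ (-i.1)))) ^ 2 * (2 * (A * (2 : ℝ) ^ (-i.1))) := by gcongr
      _ = D ^ 2 / (2 * A) * 2 ^ i.1 := by
        rw [zpow_neg]
        have : (2 : ℝ) ^ i.1 ≠ 0 := by positivity
        field_simp
  have hsum : ∑ i ∈ s, D ^ 2 / (2 * A) * (2 : ℝ) ^ i.1 ≤ 2 * M * D := by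
    rcases hD0.eq_or_lt with hD | hD
    · simp [← hD]
    have hcard : ∀ k : ℤ, (s.filter fun i => i.1 = k).card ≤ M := by
      intro k
      rcases (s.filter fun i => i.1 = k).eq_empty_or_nonempty with h | ⟨i₀, hi₀⟩
      · simp [h]
      have hinj : InjOn (Prod.snd : ℤ × X → X) (s.filter fun i => i.1 = k) := by
        intro i hi j hj hij
        rw [Finset.mem_coe, Finset.mem_filter] at hi hj
        exact Prod.ext (hi.2.trans hj.2.symm) hij
      rw [← Finset.card_image_of_injOn hinj]
      refine hM i₀.2 ((2 : ℝ) ^ (-k)) _ (by positivity) ?_ ?_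
      · rintro x hx'
        obtain ⟨i, hi, rfl⟩ := Finset.mem_image.1 hx'
        rw [Finset.mem_filter] at hi hi₀
        have := (hs i₀ hi₀.1).2 i.2 (hx i hi.1)
        rwa [hi₀.2] at this
      · intro x hx' y hy'
        obtain ⟨i, hi, rfl⟩ := Finset.mem_image.1 hx'
        obtain ⟨j, hj, rfl⟩ := Finset.mem_image.1 hy'
        rw [Finset.mem_filter] at hi hj
        refine hnet.2.2 k _ ?_ _ ?_
        · rw [← hi.2]; exact (hs i hi.1).1
        · rw [← hj.2]; exact (hs j hj.1).1
    have h2 : ∑ k ∈ s.image Prod.fst, (2 : ℝ) ^ k ≤ 2 * (2 * A / D) := by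
      refine sum_two_zpow_le (by positivity) fun k hk => ?_
      obtain ⟨i, hi, rfl⟩ := Finset.mem_image.1 hk
      have hDr : D ≤ 2 * (A * (2 : ℝ) ^ (-i.1)) := by
        refine diam_le_of_forall_dist_le (by have := hr i; positivity) fun y hy z hz => ?_
        linarith [(hs i hi).2 y hy, (hs i hi).2 z hz, dist_triangle_right y z i.2]
      rw [le_div_iff₀ hD]
      calc (2 : ℝ) ^ i.1 * D ≤ 2 ^ i.1 * (2 * (A * (2 : ℝ) ^ (-i.1))) := by gcongr
        _ = 2 * A := by
          rw [zpow_neg]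
          have : (2 : ℝ) ^ i.1 ≠ 0 := by positivity
          field_simp
    calc ∑ i ∈ s, D ^ 2 / (2 * A) * (2 : ℝ) ^ i.1
        = D ^ 2 / (2 * A) * ∑ k ∈ s.image Prod.fst,
            ((s.filter fun i => i.1 = k).card : ℝ) * (2 : ℝ) ^ k := by
          rw [← Finset.mul_sum, Finset.sum_comp (fun k : ℤ => (2 : ℝ) ^ k) Prod.fst]
          simp only [nsmul_eq_mul]
      _ ≤ D ^ 2 / (2 * A) * ∑ k ∈ s.image Prod.fst, (M : ℝ) * (2 : ℝ) ^ k := by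
          gcongr with k
          exact hcard k
      _ ≤ D ^ 2 / (2 * A) * (M * (2 * (2 * A / D))) := by
          rw [← Finset.mul_sum]
          gcongr
      _ = 2 * M * D := by field_simp
  calc _ ≤ ∑ i ∈ s, ENNReal.ofReal (D ^ 2 / (2 * A) * 2 ^ i.1) :=
        Finset.sum_le_sum fun i hi => ENNReal.ofReal_le_ofReal (hterm i hi)
    _ = ENNReal.ofReal (∑ i ∈ s, D ^ 2 / (2 * A) * (2 : ℝ) ^ i.1) :=
        (ENNReal.ofReal_sum_of_nonneg fun i _ => by positivity).symm
    _ ≤ ENNReal.ofReal (2 * M * D) := ENNReal.ofReal_le_ofReal hsum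
    _ = ENNReal.ofReal (2 * M) * ENNReal.ofReal D := ENNReal.ofReal_mul (by positivity)
    _ ≤ _ := by gcongr; exact hΓ.ofReal_diam_le_hausdorffMeasure Subset.rfl

/-- Theorem 1.3(iii): necessary condition in a finite-dimensional normed space, with
exponent `p = 2`; the constant may depend on the space. -/
theorem statement6 (X : Type u) [NormedAddCommGroup X] [NormedSpace ℝ X]
    [FiniteDimensional ℝ X] [MeasurableSpace X] [BorelSpace X] (A : ℝ) (hA : 1 < A) :
    ∃ C : ℝ, 0 < C ∧
      ∀ (Γ E : Set X) (net : ℤ → Set X),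
        IsRectifiableCurve Γ → E.Nonempty → E ⊆ Γ → IsPartialMultiresolution E net →
        SEp E net A 2 ≤ ENNReal.ofReal C * μH[1] Γ := by
  rcases subsingleton_or_nontrivial X with hX | hX
  · refine ⟨1, one_pos, fun Γ E net _ _ _ _ => ?_⟩
    simp [SEp, betaSum, Metric.diam_subsingleton (subsingleton_of_subsingleton)]
  obtain ⟨C₁, hC₁, hsmall⟩ := exists_sum_jonesBeta_le_of_not_covered X hA
  obtain ⟨C₂, hC₂, hlarge⟩ := exists_sum_jonesBeta_le_of_covered X hA
  have hC : ENNReal.ofReal (1 + C₁.toReal + C₂.toReal) = 1 + (C₁ + C₂) := by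
    rw [add_assoc, ENNReal.ofReal_add zero_le_one (by positivity), ENNReal.ofReal_one,
      ENNReal.ofReal_add (by positivity) (by positivity), ENNReal.ofReal_toReal hC₁,
      ENNReal.ofReal_toReal hC₂]
  refine ⟨1 + C₁.toReal + C₂.toReal, by positivity, ?_⟩
  rintro Γ E net ⟨⟨f, hf, rfl⟩, htop⟩ - hE hnet
  have hpath : IsPathConnected (f '' Icc (0 : ℝ) 1) :=
    ((convex_Icc (0 : ℝ) 1).isPathConnected ⟨0, by simp⟩).image' hf
  have hcomp : IsCompact (f '' Icc (0 : ℝ) 1) := isCompact_Icc.image_of_continuousOn hf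
  have hconn := hpath.isConnected.isPreconnected
  rw [hC, add_mul, one_mul]
  refine add_le_add (hconn.ofReal_diam_le_hausdorffMeasure hE) ?_
  set Γ := f '' Icc (0 : ℝ) 1
  rw [betaSum, ← ENNReal.tsum_sigma fun (k : ℤ) (x : net k) =>
    ENNReal.ofReal (jonesBeta E (closedBall (x : X) (A * (2 : ℝ) ^ (-k))) ^ (2 : ℝ) *
      Metric.diam (closedBall (x : X) (A * (2 : ℝ) ^ (-k)))), ENNReal.tsum_eq_iSup_sum]
  refine iSup_le fun s => ?_
  let e : (Σ k : ℤ, net k) ↪ ℤ × X := ⟨fun i => (i.1, i.2), by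
    rintro ⟨k, x⟩ ⟨k', x'⟩ h
    obtain ⟨rfl, h⟩ := Prod.ext_iff.1 h
    obtain rfl := Subtype.ext h
    rfl⟩
  let T : ℤ × X → ℝ≥0∞ := fun i =>
    ENNReal.ofReal (jonesBeta E (closedBall i.2 (A * (2 : ℝ) ^ (-i.1))) ^ 2 *
        (2 * (A * (2 : ℝ) ^ (-i.1))))
  have hmem : ∀ i ∈ s.map e, i.2 ∈ net i.1 := by
    intro i hi
    obtain ⟨j, -, rfl⟩ := Finset.mem_map.1 hi
    exact j.2.2
  calc _ = ∑ i ∈ s.map e, T i := by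
        rw [Finset.sum_map]
        refine Finset.sum_congr rfl fun i _ => ?_
        rw [Metric.diam_closedBall_eq _ (by positivity), Real.rpow_two]
        rfl
    _ = ∑ i ∈ (s.map e).filter (fun i => ∃ y ∈ Γ, A * (2 : ℝ) ^ (-i.1) ≤ dist y i.2), T i +
        ∑ i ∈ (s.map e).filter (fun i => ¬ ∃ y ∈ Γ, A * (2 : ℝ) ^ (-i.1) ≤ dist y i.2), T i :=
      (Finset.sum_filter_add_sum_filter_not _ _ _).symm
    _ ≤ C₁ * μH[1] Γ + C₂ * μH[1] Γ := by
      refine add_le_add (hsmall Γ E net hpath hcomp.isClosed htop.ne hE hnet _ fun i hi => ?_)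
        (hlarge Γ E net hconn hcomp.isBounded hE hnet _ fun i hi => ?_)
      · rw [Finset.mem_filter] at hi
        exact ⟨hmem i hi.1, hi.2⟩
      · rw [Finset.mem_filter] at hi
        push Not at hi
        exact ⟨hmem i hi.1, fun y hy => (hi.2 y hy).le⟩
    _ = _ := by rw [add_mul]

end
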